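/- arXiv:2402.12734 — 4 statements merged into one kernel-verified Lean document; each statement's English description precedes it below -/
import Mathlib

section
/- For every integer k ≥ 2, every integer ℓ ≥ 1, and every online algorithm A for OFAL_eq(k,ℓ) that is a permutation algorithm, the competitive ratio satisfies R_{k,ℓ}(A) ≥ k+1; equivalently, for every real α < k+1 there exists a request sequence σ (of length at most kℓ) with A_ℓ(σ) > α·OPT_ℓ(σ). -/
/-!
OFAL_eq(k,ℓ): k servers at positions 0,1,...,k-1 (server i+1 at position i for
i : Fin k), each with capacity ℓ.  An online algorithm is `A : List ℝ → Fin k`,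
assigning the last request of each nonempty prefix to a server.  We show:
if `A` is a permutation algorithm, then for every α < k+1 there is a request
sequence σ (of length ≤ kℓ) with A_ℓ(σ) > α · OPT_ℓ(σ).
-/

/-- Online cost of algorithm `A` on request sequence `σ`: the `i`-th request
(0-indexed) is assigned to server `A (σ.take (i+1))`, located at position
`(A (σ.take (i+1)) : ℕ)`. -/
noncomputable def algCost (k : ℕ) (A : List ℝ → Fin k) (σ : List ℝ) : ℝ :=
  ∑ i ∈ Finset.range σ.length, |σ.getD i 0 - ((A (σ.take (i + 1))).val : ℝ)|

/-- Optimal offline cost with capacity `c` for request sequence `σ`: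
infimum over all assignments `f` that use each server at most `c` times. -/
noncomputable def optCost (k c : ℕ) (σ : List ℝ) : ℝ :=
  sInf {x : ℝ | ∃ f : Fin σ.length → Fin k,
    (∀ s : Fin k, (Finset.univ.filter fun i => f i = s).card ≤ c) ∧
    x = ∑ i : Fin σ.length, |σ.get i - ((f i).val : ℝ)|}

/-- `A` is feasible for capacity `c`: along any request sequence of length
`≤ k * c`, no server is chosen more than `c` times. -/
def Feasible (k c : ℕ) (A : List ℝ → Fin k) : Prop :=
  ∀ σ : List ℝ, σ.length ≤ k * c →
    ∀ s : Fin k,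
      ((Finset.range σ.length).filter fun i => A (σ.take (i + 1)) = s).card ≤ c

/-- `A` is a permutation algorithm for capacity `ℓ`: for every request sequence
`σ` there are optimal assignments `M i` of each prefix `σ.take i` (encoded as
`M : ℕ → ℕ → Fin k`, where `M i j` is the server of the `j`-th request, `j < i`)
such that the multiset of servers used by `M i` is that of `M (i-1)` with
exactly one new occurrence, namely the server `A (σ.take i)` chosen online. -/
def IsPermAlg (k ℓ : ℕ) (A : List ℝ → Fin k) : Prop :=
  ∀ σ : List ℝ, σ.length ≤ k * ℓ →
    ∃ M : ℕ → ℕ → Fin k,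
      ∀ i, 1 ≤ i → i ≤ σ.length →
        (∀ s : Fin k, ((Finset.range i).filter fun j => M i j = s).card ≤ ℓ) ∧
        (∀ g : ℕ → Fin k,
          (∀ s : Fin k, ((Finset.range i).filter fun j => g j = s).card ≤ ℓ) →
          ∑ j ∈ Finset.range i, |σ.getD j 0 - ((M i j).val : ℝ)| ≤
            ∑ j ∈ Finset.range i, |σ.getD j 0 - ((g j).val : ℝ)|) ∧
        (∀ s : Fin k,
          ((Finset.range i).filter fun j => M i j = s).card =
            ((Finset.range (i - 1)).filter fun j => M (i - 1) j = s).card +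
              (if s = A (σ.take i) then 1 else 0))

theorem sum_val_eq_sum_card_mul {k : ℕ} (f : ℕ → Fin k) (i : ℕ) :
    ∑ j ∈ Finset.range i, ((f j).val : ℝ) =
      ∑ s : Fin k, (((Finset.range i).filter fun j => f j = s).card : ℝ) * (s.val : ℝ) := by
  rw [← Finset.sum_fiberwise (Finset.range i) f]
  refine Finset.sum_congr rfl fun s _ => ?_
  rw [Finset.sum_congr rfl (g := fun _ => (s.val : ℝ))]
  · simp
  · intro j hj
    rw [(Finset.mem_filter.mp hj).2]

/-- The net displacement of a permutation algorithm on a prefix is bounded by the cost of any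
feasible assignment of that prefix. -/
theorem IsPermAlg.abs_sum_sub_le {k ℓ : ℕ} {A : List ℝ → Fin k} (hperm : IsPermAlg k ℓ A)
    {σ : List ℝ} (hσ : σ.length ≤ k * ℓ) {i : ℕ} (hi : 1 ≤ i) (hiσ : i ≤ σ.length) (g : ℕ → ℕ)
    (hgk : ∀ j, j < i → g j < k)
    (hg : ∀ s, ((Finset.range i).filter fun j => g j = s).card ≤ ℓ) :
    |∑ j ∈ Finset.range i, (σ.getD j 0 - ((A (σ.take (j + 1))).val : ℝ))| ≤
      ∑ j ∈ Finset.range i, |σ.getD j 0 - (g j : ℝ)| := by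
  obtain ⟨M, hM⟩ := hperm σ hσ
  have hsum : ∀ i, i ≤ σ.length → ∑ j ∈ Finset.range i, ((M i j).val : ℝ) =
      ∑ j ∈ Finset.range i, ((A (σ.take (j + 1))).val : ℝ) := by
    intro i
    induction i with
    | zero => simp
    | succ i ih =>
      intro h
      have h3 := (hM (i + 1) (by omega) h).2.2
      rw [Finset.sum_range_succ (fun j => ((A (σ.take (j + 1))).val : ℝ)), ← ih (by omega),
        sum_val_eq_sum_card_mul, sum_val_eq_sum_card_mul]
      simp only [h3, Nat.add_sub_cancel]
      push_cast
      simp [add_mul, Finset.sum_add_distrib]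
  have hk : 0 < k := lt_of_le_of_lt (Nat.zero_le _) (hgk 0 hi)
  obtain ⟨-, h2, -⟩ := hM i hi hiσ
  let g' : ℕ → Fin k := fun j => ⟨g j % k, Nat.mod_lt _ hk⟩
  have hg' : ∀ j, j < i → (g' j).val = g j := fun j hj => Nat.mod_eq_of_lt (hgk j hj)
  have h4 := h2 g' (by
    intro s
    refine le_trans (le_of_eq ?_) (hg s.val)
    congr 1
    refine Finset.filter_congr fun j hj => ?_
    rw [Fin.ext_iff, hg' j (Finset.mem_range.mp hj)])
  calc _ = |∑ j ∈ Finset.range i, (σ.getD j 0 - ((M i j).val : ℝ))| := by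
        rw [Finset.sum_sub_distrib, Finset.sum_sub_distrib, hsum i hiσ]
    _ ≤ ∑ j ∈ Finset.range i, |σ.getD j 0 - ((M i j).val : ℝ)| := Finset.abs_sum_le_sum_abs _ _
    _ ≤ _ := h4
    _ = _ := Finset.sum_congr rfl fun j hj => by rw [hg' j (Finset.mem_range.mp hj)]

theorem optCost_le {k c : ℕ} {σ : List ℝ} (g : ℕ → ℕ)
    (hgk : ∀ j, j < σ.length → g j < k)
    (hg : ∀ s, ((Finset.range σ.length).filter fun j => g j = s).card ≤ c) :
    optCost k c σ ≤ ∑ j ∈ Finset.range σ.length, |σ.getD j 0 - (g j : ℝ)| := by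
  refine csInf_le ⟨0, ?_⟩ ⟨fun j => ⟨g j, hgk j j.2⟩, ?_, ?_⟩
  · rintro x ⟨f, -, rfl⟩
    positivity
  · intro s
    refine le_trans (le_of_eq ?_) (hg s.val)
    rw [Finset.card_filter, Finset.card_filter,
      ← Fin.sum_univ_eq_sum_range (fun j => if g j = s.val then 1 else 0)]
    simp only [Fin.ext_iff]
  · rw [← Fin.sum_univ_eq_sum_range (fun j => |σ.getD j 0 - (g j : ℝ)|)]
    simp

theorem optCost_nonneg (k c : ℕ) (σ : List ℝ) : 0 ≤ optCost k c σ := by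
  refine Real.sInf_nonneg ?_
  rintro x ⟨f, -, rfl⟩
  positivity

theorem card_filter_mod_eq {k s : ℕ} (hs : s < k) (c : ℕ) :
    ((Finset.range (k * c)).filter fun j => j % k = s).card = c := by
  induction c with
  | zero => simp
  | succ c ih =>
    rw [Finset.card_filter] at ih ⊢
    rw [Nat.mul_succ, Finset.sum_range_add, ih]
    congr 1
    rw [Finset.sum_congr rfl (g := fun j => if j = s then 1 else 0)]
    · simp [hs]
    · intro j hj
      rw [Nat.mul_add_mod, Nat.mod_eq_of_lt (Finset.mem_range.mp hj)]

/-- The sequence that runs through `0, …, k - 1` cyclically `c` times and then follows `f`. -/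
def cycleThen {R : Type*} [NatCast R] (k c : ℕ) (f : ℕ → R) (j : ℕ) : R :=
  if j < k * c then ((j % k : ℕ) : R) else f (j - k * c)

theorem cycleThen_of_lt {R : Type*} [NatCast R] {k c j : ℕ} (f : ℕ → R) (h : j < k * c) :
    cycleThen k c f j = ((j % k : ℕ) : R) := if_pos h

theorem cycleThen_add {R : Type*} [NatCast R] (k c u : ℕ) (f : ℕ → R) :
    cycleThen k c f (k * c + u) = f u := by
  simp [cycleThen]

theorem cycleThen_lt {k c n : ℕ} (hk : 0 < k) {f : ℕ → ℕ} (hf : ∀ u, u < n → f u < k) (j : ℕ)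
    (hj : j < k * c + n) : cycleThen k c f j < k := by
  unfold cycleThen
  split_ifs with h
  · exact Nat.mod_lt _ hk
  · exact hf _ (by omega)

theorem card_filter_cycleThen_le {k c n : ℕ} (hk : 0 < k) {f : ℕ → ℕ}
    (hinj : Set.InjOn f (Set.Iio n)) (s : ℕ) :
    ((Finset.range (k * c + n)).filter fun j => cycleThen k c f j = s).card ≤ c + 1 := by
  have h1 : ((Finset.range n).filter fun u => f u = s).card ≤ 1 := by
    refine Finset.card_le_one.mpr fun u hu v hv => ?_
    simp only [Finset.mem_filter, Finset.mem_range] at hu hv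
    exact hinj hu.1 hv.1 (hu.2.trans hv.2.symm)
  have h2 : ((Finset.range (k * c)).filter fun j => j % k = s).card ≤ c := by
    by_cases hs : s < k
    · exact (card_filter_mod_eq hs c).le
    · rw [Finset.filter_false_of_mem]
      · simp
      · intro j _ h
        exact hs (h ▸ Nat.mod_lt _ hk)
  rw [Finset.card_filter] at h1 h2 ⊢
  rw [Finset.sum_range_add]
  refine add_le_add (le_trans (Finset.sum_le_sum fun j hj => ?_) h2)
    (le_trans (Finset.sum_le_sum fun j hj => ?_) h1)
  · rw [cycleThen_of_lt _ (Finset.mem_range.mp hj)]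
    simp
  · rw [cycleThen_add]

theorem sum_abs_cycleThen_sub (k c n : ℕ) (f : ℕ → ℝ) (g : ℕ → ℕ) :
    ∑ j ∈ Finset.range (k * c + n), |cycleThen k c f j - ((cycleThen k c g j : ℕ) : ℝ)| =
      ∑ u ∈ Finset.range n, |f u - (g u : ℝ)| := by
  rw [Finset.sum_range_add, Finset.sum_eq_zero, zero_add]
  · simp only [cycleThen_add]
  · intro j hj
    simp [cycleThen_of_lt _ (Finset.mem_range.mp hj)]

/-- The order in which the algorithm is made to fill the servers: outwards from the middle,
alternating between the two sides. -/
def fillOrder (k t : ℕ) : ℕ :=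
  if t % 2 = 0 then k / 2 + t / 2 else k / 2 - (t + 1) / 2

/-- The reflection of `fillOrder`. -/
def mirrorOrder (k t : ℕ) : ℕ :=
  if t % 2 = 0 then k / 2 - t / 2 else k / 2 + (t + 1) / 2

/-- An optimal matching of the first `t + 1` perturbed midpoint requests. -/
def shiftedOrder (k t u : ℕ) : ℕ :=
  if t % 2 = 0 then mirrorOrder k u else mirrorOrder k u - 1

theorem fillOrder_lt {k t : ℕ} (ht : t < k) : fillOrder k t < k := by
  unfold fillOrder; split_ifs <;> omega

theorem fillOrder_injOn (k : ℕ) : Set.InjOn (fillOrder k) (Set.Iio k) := by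
  intro t ht u hu h
  simp only [Set.mem_Iio] at ht hu
  unfold fillOrder at h; split_ifs at h <;> omega

theorem exists_fillOrder_eq {k a : ℕ} (ha : a < k) : ∃ u < k, fillOrder k u = a := by
  by_cases h : k / 2 ≤ a
  · refine ⟨2 * (a - k / 2), by omega, ?_⟩
    rw [fillOrder, if_pos (by omega)]; omega
  · refine ⟨2 * (k / 2 - a) - 1, by omega, ?_⟩
    rw [fillOrder, if_neg (by omega)]; omega

theorem shiftedOrder_lt {k t u : ℕ} (ht : t < k) (hu : u ≤ t) : shiftedOrder k t u < k := by
  unfold shiftedOrder mirrorOrder; split_ifs <;> omega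

theorem shiftedOrder_injOn {k t : ℕ} (ht : t < k) :
    Set.InjOn (shiftedOrder k t) (Set.Iio (t + 1)) := by
  intro u hu v hv h
  simp only [Set.mem_Iio] at hu hv
  unfold shiftedOrder mirrorOrder at h; split_ifs at h <;> omega

/-- The perturbation applied to the `u`-th midpoint request. -/
def perturbation (ε : ℝ) (u : ℕ) : ℝ := if u = 0 then ε else (-1) ^ u * (2 * ε)

theorem sum_perturbation (ε : ℝ) (t : ℕ) :
    ∑ u ∈ Finset.range (t + 1), perturbation ε u = (-1) ^ t * ε := by
  induction t with
  | zero => simp [perturbation]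
  | succ t ih =>
    rw [Finset.sum_range_succ, ih, perturbation, if_neg (by omega), pow_succ]
    ring

theorem abs_perturbation_le {ε : ℝ} (hε : 0 ≤ ε) (u : ℕ) : |perturbation ε u| ≤ 2 * ε := by
  unfold perturbation
  split_ifs
  · rw [abs_of_nonneg hε]; linarith
  · rw [abs_mul, abs_pow, abs_neg, abs_one, one_pow, one_mul, abs_of_nonneg (by linarith)]

/-- The hard requests: perturbed midpoints around the middle server, and finally a request at the
occupied end of the line. -/
noncomputable def hardRequest (k : ℕ) (ε : ℝ) (u : ℕ) : ℝ :=
  if u + 1 < k then (mirrorOrder k u : ℝ) - 1 / 2 + perturbation ε u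
  else (shiftedOrder k u u : ℝ)

theorem hardRequest_sub_fillOrder {k u : ℕ} (hu : u + 1 < k) (ε : ℝ) :
    hardRequest k ε u - (fillOrder k u : ℝ) =
      -((-1) ^ u * ((u : ℝ) + 1 / 2)) + perturbation ε u := by
  rw [hardRequest, if_pos hu]
  rcases Nat.even_or_odd' u with ⟨v, rfl | rfl⟩
  · have h1 : mirrorOrder k (2 * v) + 2 * v = fillOrder k (2 * v) := by
      unfold mirrorOrder fillOrder; split_ifs <;> omega
    rw [← h1, pow_mul]
    push_cast; norm_num; ring
  · have h1 : fillOrder k (2 * v + 1) + (2 * v + 2) = mirrorOrder k (2 * v + 1) := by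
      unfold mirrorOrder fillOrder; split_ifs <;> omega
    rw [← h1, pow_succ, pow_mul]
    push_cast; norm_num; ring

theorem sum_hardRequest_sub_fillOrder {k t : ℕ} (ht : t + 1 < k) (ε : ℝ) :
    ∑ u ∈ Finset.range (t + 1), (hardRequest k ε u - (fillOrder k u : ℝ)) =
      (-1) ^ t * (ε - ((t : ℝ) + 1) / 2) := by
  rw [Finset.sum_congr rfl fun u hu => hardRequest_sub_fillOrder
    (by have := Finset.mem_range.mp hu; omega) ε, Finset.sum_add_distrib, sum_perturbation]
  have h : ∑ u ∈ Finset.range (t + 1), -((-1 : ℝ) ^ u * ((u : ℝ) + 1 / 2)) =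
      -((-1) ^ t * (((t : ℝ) + 1) / 2)) := by
    clear ht
    induction t with
    | zero => norm_num
    | succ t ih => rw [Finset.sum_range_succ, ih, pow_succ]; push_cast; ring
  rw [h]; ring

theorem abs_hardRequest_sub_shiftedOrder {k u : ℕ} (hu : u + 1 < k) {ε : ℝ} (hε : 0 ≤ ε)
    (hε' : ε ≤ 1 / 4) (t : ℕ) :
    |hardRequest k ε u - (shiftedOrder k t u : ℝ)| = 1 / 2 - (-1) ^ t * perturbation ε u := by
  have hp := abs_le.mp (abs_perturbation_le hε u)
  rw [hardRequest, if_pos hu]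
  rcases Nat.even_or_odd t with h | h
  · rw [shiftedOrder, if_pos (Nat.even_iff.mp h), h.neg_one_pow, abs_of_nonpos (by linarith)]
    ring
  · have h1 : 1 ≤ mirrorOrder k u := by unfold mirrorOrder; split_ifs <;> omega
    rw [shiftedOrder, if_neg (by rw [Nat.odd_iff.mp h]; simp), h.neg_one_pow, Nat.cast_sub h1,
      abs_of_nonneg (by push_cast; linarith)]
    push_cast; ring

theorem sum_abs_hardRequest_sub_shiftedOrder {k n : ℕ} (hn : n + 1 < k) {ε : ℝ} (hε : 0 ≤ ε)
    (hε' : ε ≤ 1 / 4) (t : ℕ) :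
    ∑ u ∈ Finset.range (n + 1), |hardRequest k ε u - (shiftedOrder k t u : ℝ)| =
      ((n : ℝ) + 1) / 2 - (-1) ^ t * (-1) ^ n * ε := by
  rw [Finset.sum_congr rfl fun u hu => abs_hardRequest_sub_shiftedOrder
    (by have := Finset.mem_range.mp hu; omega) hε hε' t, Finset.sum_sub_distrib,
    ← Finset.mul_sum, sum_perturbation]
  simp; ring

/-- Among the servers filled from time `t` on, only `fillOrder k t` is compatible with the
displacement bound. -/
theorem eq_of_abs_displacement_le {k t u : ℕ} (htu : t ≤ u) (hu : u < k) {ε : ℝ} (hε : 0 < ε)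
    (h : |(-1) ^ t * (ε - ((t : ℝ) + 1) / 2) + ((fillOrder k t : ℝ) - (fillOrder k u : ℝ))| ≤
      ((t : ℝ) + 1) / 2 - ε) : u = t := by
  have h' := abs_le.mp h
  rcases Nat.even_or_odd t with ht | ht
  · rw [ht.neg_one_pow] at h'
    have h1 : fillOrder k u ≤ fillOrder k t := by
      have : (fillOrder k u : ℝ) ≤ fillOrder k t := by linarith
      exact_mod_cast this
    have h2 : fillOrder k t < fillOrder k u + (t + 1) := by
      have : (fillOrder k t : ℝ) < fillOrder k u + (t + 1) := by linarith
      exact_mod_cast this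
    rw [Nat.even_iff] at ht
    unfold fillOrder at h1 h2
    split_ifs at h1 h2 <;> omega
  · rw [ht.neg_one_pow] at h'
    have h1 : fillOrder k t ≤ fillOrder k u := by
      have : (fillOrder k t : ℝ) ≤ fillOrder k u := by linarith
      exact_mod_cast this
    have h2 : fillOrder k u < fillOrder k t + (t + 1) := by
      have : (fillOrder k u : ℝ) < fillOrder k t + (t + 1) := by linarith
      exact_mod_cast this
    rw [Nat.odd_iff] at ht
    unfold fillOrder at h1 h2
    split_ifs at h1 h2 <;> omega

/-- The displacement bounds and the capacities determine the servers used on the hard sequence. -/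
theorem eq_cycleThen_fillOrder {k c : ℕ} (hk : 0 < k) {ε : ℝ} (hε : 0 < ε) (hε' : ε ≤ 1 / 4)
    {a : ℕ → ℕ} (hak : ∀ j, a j < k)
    (hcap : ∀ s < k, ((Finset.range (k * c + k)).filter fun j => a j = s).card ≤ c + 1)
    (hdisp : ∀ i, 1 ≤ i → i ≤ k * c + k → ∀ g : ℕ → ℕ, (∀ j, j < i → g j < k) →
      (∀ s, ((Finset.range i).filter fun j => g j = s).card ≤ c + 1) →
      |∑ j ∈ Finset.range i, (cycleThen k c (hardRequest k ε) j - (a j : ℝ))| ≤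
        ∑ j ∈ Finset.range i, |cycleThen k c (hardRequest k ε) j - (g j : ℝ)|) :
    ∀ j, j < k * c + k → a j = cycleThen k c (fillOrder k) j := by
  intro i
  induction i using Nat.strong_induction_on with
  | _ i ih =>
  intro hi
  by_cases hic : i < k * c
  · have h := hdisp (i + 1) (by omega) (by omega) (cycleThen k c (fillOrder k))
      (fun j hj => cycleThen_lt hk (n := k) (fun u hu => fillOrder_lt hu) j (by omega))
      (fun s => le_trans (Finset.card_le_card
        (Finset.filter_subset_filter _ (Finset.range_subset_range.mpr (by omega))))
        (card_filter_cycleThen_le (n := k) hk (fillOrder_injOn k) s))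
    have hz : ∀ j, j < k * c → cycleThen k c (hardRequest k ε) j =
        ((cycleThen k c (fillOrder k) j : ℕ) : ℝ) := fun j hj => by
      simp [cycleThen_of_lt _ hj]
    rw [Finset.sum_range_succ, Finset.sum_eq_zero, zero_add,
      Finset.sum_eq_zero (s := Finset.range (i + 1)), abs_nonpos_iff, hz i hic, sub_eq_zero] at h
    · exact_mod_cast h.symm
    · intro j hj
      rw [hz j (by have := Finset.mem_range.mp hj; omega), sub_self, abs_zero]
    · intro j hj
      have := Finset.mem_range.mp hj
      rw [hz j (by omega), ih j this (by omega), sub_self]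
  obtain ⟨t, rfl⟩ := Nat.exists_eq_add_of_le (not_lt.mp hic)
  rw [cycleThen_add]
  obtain ⟨u, huk, hu⟩ := exists_fillOrder_eq (hak (k * c + t))
  have htu : t ≤ u := by
    by_contra! hut
    have h := hcap (fillOrder k u) (fillOrder_lt huk)
    have h1 : ∑ j ∈ Finset.range (k * c), (if a j = fillOrder k u then 1 else 0) = c := by
      refine Eq.trans ?_ (card_filter_mod_eq (fillOrder_lt huk) c)
      rw [Finset.card_filter]
      refine Finset.sum_congr rfl fun j hj => ?_
      have := Finset.mem_range.mp hj
      rw [ih j (by omega) (by omega), cycleThen_of_lt _ this]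
      simp
    rw [Finset.card_filter, Finset.sum_range_add, h1] at h
    have h2 : ∑ v ∈ {u, t}, (if a (k * c + v) = fillOrder k u then 1 else 0) ≤
        ∑ v ∈ Finset.range k, (if a (k * c + v) = fillOrder k u then 1 else 0) := by
      refine Finset.sum_le_sum_of_subset fun v hv => ?_
      simp only [Finset.mem_insert, Finset.mem_singleton] at hv
      rw [Finset.mem_range]
      omega
    rw [Finset.sum_pair hut.ne, ih (k * c + u) (by omega) (by omega), cycleThen_add, if_pos rfl,
      if_pos hu.symm] at h2
    omega
  rcases eq_or_lt_of_le (show t + 1 ≤ k by omega) with htk | htk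
  · rw [← hu, show u = t by omega]
  have h := hdisp (k * c + (t + 1)) (by omega) (by omega) (cycleThen k c (shiftedOrder k t))
    (cycleThen_lt hk fun v hv => shiftedOrder_lt (by omega) (by omega))
    (card_filter_cycleThen_le hk (shiftedOrder_injOn (by omega)))
  rw [sum_abs_cycleThen_sub, sum_abs_hardRequest_sub_shiftedOrder htk hε.le hε',
    Finset.sum_range_add, Finset.sum_eq_zero (s := Finset.range (k * c)), zero_add,
    Finset.sum_range_succ, ← mul_pow] at h
  · have hD := sum_hardRequest_sub_fillOrder htk ε
    rw [Finset.sum_range_succ] at hD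
    rw [Finset.sum_congr rfl (g := fun v => hardRequest k ε v - (fillOrder k v : ℝ)), ← hu,
      cycleThen_add] at h
    · rw [← hu, eq_of_abs_displacement_le htu huk hε]
      rw [← hD]
      norm_num [-Finset.sum_sub_distrib] at h
      refine le_trans (le_of_eq (congrArg _ ?_)) h
      ring
    · intro v hv
      have := Finset.mem_range.mp hv
      rw [ih (k * c + v) (by omega) (by omega), cycleThen_add, cycleThen_add]
  · intro j hj
    have := Finset.mem_range.mp hj
    rw [ih j (by omega) (by omega)]
    simp [cycleThen_of_lt _ this]

theorem sum_abs_hardRequest_sub_fillOrder_ge {n : ℕ} {ε : ℝ} (hε : 0 ≤ ε) :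
    ((n : ℝ) + 1) * (n + 3) / 2 - 2 * (n + 1) * ε ≤
      ∑ u ∈ Finset.range (n + 2), |hardRequest (n + 2) ε u - (fillOrder (n + 2) u : ℝ)| := by
  have hlast : |hardRequest (n + 2) ε (n + 1) - (fillOrder (n + 2) (n + 1) : ℝ)| = n + 1 := by
    rw [hardRequest, if_neg (by omega)]
    rcases Nat.even_or_odd' n with ⟨v, rfl | rfl⟩
    · have h1 : shiftedOrder (2 * v + 2) (2 * v + 1) (2 * v + 1) = 2 * v + 1 := by
        unfold shiftedOrder mirrorOrder; split_ifs <;> omega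
      have h2 : fillOrder (2 * v + 2) (2 * v + 1) = 0 := by
        unfold fillOrder; split_ifs <;> omega
      rw [h1, h2, Nat.cast_zero, sub_zero, abs_of_nonneg (by positivity)]
      push_cast; ring
    · have h1 : shiftedOrder (2 * v + 1 + 2) (2 * v + 1 + 1) (2 * v + 1 + 1) = 0 := by
        unfold shiftedOrder mirrorOrder; split_ifs <;> omega
      have h2 : fillOrder (2 * v + 1 + 2) (2 * v + 1 + 1) = 2 * v + 2 := by
        unfold fillOrder; split_ifs <;> omega
      rw [h1, h2, abs_of_nonpos (by push_cast; linarith [(Nat.cast_nonneg v : (0 : ℝ) ≤ v)])]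
      push_cast; ring
  have hsum : ∑ u ∈ Finset.range (n + 1), ((u : ℝ) + 1 / 2 - 2 * ε) =
      ((n : ℝ) + 1) ^ 2 / 2 - 2 * (n + 1) * ε := by
    clear hlast
    induction n with
    | zero => norm_num
    | succ n ih => rw [Finset.sum_range_succ, ih]; push_cast; ring
  have hle : ∑ u ∈ Finset.range (n + 1), ((u : ℝ) + 1 / 2 - 2 * ε) ≤
      ∑ u ∈ Finset.range (n + 1), |hardRequest (n + 2) ε u - (fillOrder (n + 2) u : ℝ)| := by
    refine Finset.sum_le_sum fun u hu => ?_
    have := Finset.mem_range.mp hu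
    rw [hardRequest_sub_fillOrder (by omega)]
    have h1 := abs_sub_abs_le_abs_add (-((-1) ^ u * ((u : ℝ) + 1 / 2))) (perturbation ε u)
    have h2 := abs_perturbation_le hε u
    rw [abs_neg, abs_mul, abs_pow, abs_neg, abs_one, one_pow, one_mul,
      abs_of_nonneg (by positivity)] at h1
    linarith
  rw [Finset.sum_range_succ, hlast]
  linarith

/-- The competitive ratio of any permutation algorithm for OFAL_eq(k,ℓ) is at
least k+1: for every α < k+1 there is a request sequence σ with
A_ℓ(σ) > α · OPT_ℓ(σ). -/
theorem perm_competitive_ratio_ge (k ℓ : ℕ) (hk : 2 ≤ k) (hℓ : 1 ≤ ℓ)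
    (A : List ℝ → Fin k) (hA : Feasible k ℓ A) (hperm : IsPermAlg k ℓ A) :
    ∀ α : ℝ, α < (k : ℝ) + 1 →
      ∃ σ : List ℝ, σ.length ≤ k * ℓ ∧ algCost k A σ > α * optCost k ℓ σ := by
  intro α hα
  obtain ⟨c, rfl⟩ := Nat.exists_eq_add_of_le' hℓ
  obtain ⟨n, hkn⟩ := Nat.exists_eq_add_of_le' hk
  have hn : (0 : ℝ) ≤ n := Nat.cast_nonneg n
  obtain ⟨β, hβ0, hαβ, hβ⟩ : ∃ β : ℝ, 0 ≤ β ∧ α ≤ β ∧ β < n + 3 :=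
    ⟨max α 0, le_max_right _ _, le_max_left _ _,
      max_lt (by rw [hkn] at hα; push_cast at hα; linarith) (by positivity)⟩
  obtain ⟨ε, hε, hε', hεβ⟩ : ∃ ε : ℝ, 0 < ε ∧ ε ≤ 1 / 4 ∧ ε * (8 * (n + 3)) = n + 3 - β := by
    refine ⟨(n + 3 - β) / (8 * (n + 3)), div_pos (by linarith) (by positivity), ?_, ?_⟩
    · rw [div_le_iff₀ (by positivity)]; linarith
    · field_simp
  set σ := (List.range (k * c + k)).map (cycleThen k c (hardRequest k ε)) with hσ
  have hlen : σ.length = k * c + k := by simp [hσ]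
  have hget : ∀ j, j < k * c + k → σ.getD j 0 = cycleThen k c (hardRequest k ε) j := by
    intro j hj
    simp [hσ, hj]
  have hlen' : σ.length ≤ k * (c + 1) := by rw [hlen, Nat.mul_succ]
  have ha : ∀ j, j < k * c + k → (A (σ.take (j + 1))).val = cycleThen k c (fillOrder k) j := by
    refine eq_cycleThen_fillOrder (by omega) hε hε' (fun j => (A (σ.take (j + 1))).2) ?_ ?_
    · intro s hs
      have h := hA σ hlen' ⟨s, hs⟩
      simpa only [hlen, Fin.ext_iff] using h
    · intro i hi hik g hgk hg
      have h := hperm.abs_sum_sub_le hlen' hi (hlen ▸ hik) g hgk hg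
      have hgr : ∀ j ∈ Finset.range i, σ.getD j 0 = cycleThen k c (hardRequest k ε) j :=
        fun j hj => hget j ((Finset.mem_range.mp hj).trans_le hik)
      refine le_of_eq_of_le (congrArg _ ?_) (h.trans_eq ?_)
      · exact Finset.sum_congr rfl fun j hj => by rw [hgr j hj]
      · exact Finset.sum_congr rfl fun j hj => by rw [hgr j hj]
  have halg : algCost k A σ =
      ∑ u ∈ Finset.range k, |hardRequest k ε u - (fillOrder k u : ℝ)| := by
    rw [← sum_abs_cycleThen_sub k c k, algCost, hlen]
    refine Finset.sum_congr rfl fun j hj => ?_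
    rw [hget j (Finset.mem_range.mp hj), ha j (Finset.mem_range.mp hj)]
  have hopt : optCost k (c + 1) σ ≤ ((n : ℝ) + 1) / 2 + ε := by
    refine (optCost_le (cycleThen k c (shiftedOrder k (n + 1))) ?_ ?_).trans ?_
    · rw [hlen]
      exact cycleThen_lt (n := k) (by omega) fun u hu =>
        shiftedOrder_lt (t := n + 1) (by omega) (by omega)
    · rw [hlen]
      exact card_filter_cycleThen_le (by omega)
        ((shiftedOrder_injOn (t := n + 1) (by omega)).mono (Set.Iio_subset_Iio hkn.le))
    · rw [hlen, Finset.sum_congr rfl fun j hj =>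
          congrArg (fun x => |x - ((cycleThen k c (shiftedOrder k (n + 1)) j : ℕ) : ℝ)|)
            (hget j (Finset.mem_range.mp hj)),
        sum_abs_cycleThen_sub, hkn, Finset.sum_range_succ,
        sum_abs_hardRequest_sub_shiftedOrder (by omega) hε.le hε', hardRequest,
        if_neg (by omega), sub_self, abs_zero, pow_succ, mul_neg_one, neg_mul, ← mul_pow]
      norm_num
  have hge := sum_abs_hardRequest_sub_fillOrder_ge (n := n) hε.le
  rw [← hkn] at hge
  refine ⟨σ, hlen', ?_⟩
  have h1 := mul_le_mul_of_nonneg_right hαβ (optCost_nonneg k (c + 1) σ)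
  have h2 := mul_le_mul_of_nonneg_left hopt hβ0
  rw [halg]
  refine lt_of_le_of_lt (h1.trans h2) (lt_of_lt_of_le ?_ hge)
  nlinarith [mul_pos hε hε, mul_nonneg hn hε.le, mul_nonneg hn (mul_nonneg hn hε.le)]
end

section
/- For every integer k ≥ 2 and every real ε > 0, there exist reals r_1,...,r_k with the following property: for every bijection g of {1,...,k} that arises as a permutation-algorithm assignment — i.e., such that there exists a chain of injections f_1,...,f_k with f_i : {1,...,i} → {1,...,k}, where each f_i minimizes Σ_{j=1}^i |r_j - (f(j)-1)| over all injections of {1,...,i} into {1,...,k}, the image of f_i equals the image of f_{i-1} together with exactly one new index, and g(i) is that new index — one has Σ_{i=1}^k |r_i - (g(i)-1)| ≥ (k+1-ε) · min_π Σ_{i=1}^k |r_i - (π(i)-1)|, the minimum being over all bijections π of {1,...,k}. -/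
/-- The enumeration `m, m + 1, m - 1, m + 2, m - 2, …` of the integers around `m`. -/
def zigzag (m j : ℕ) : ℕ := if j % 2 = 0 then m - j / 2 else m + (j + 1) / 2

/-- The point between `zigzag m (i - 1)` and `zigzag m (i + 1)` that lies `δ` closer to the former
than their midpoint. -/
noncomputable def slot (m i : ℕ) (δ : ℝ) : ℝ :=
  if i % 2 = 0 then (m : ℝ) + (i / 2 : ℕ) + 1 / 2 - δ else (m : ℝ) - (i / 2 : ℕ) - 1 / 2 + δ

/-- The zigzag index of the server serving request `i` in the optimal assignment of the requests
`0, …, j`. -/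
def alternate (j i : ℕ) : ℕ := if i % 2 = j % 2 then i - 1 else i + 1

lemma zigzag_le {K j : ℕ} (hj : j ≤ K) : zigzag (K / 2) j ≤ K := by
  unfold zigzag; split_ifs <;> omega

lemma zigzag_inj {K i j : ℕ} (hi : i ≤ K) (hj : j ≤ K)
    (h : zigzag (K / 2) i = zigzag (K / 2) j) : i = j := by
  unfold zigzag at h; split_ifs at h <;> omega

lemma alternate_le {i j : ℕ} (hi : i ≤ j) : alternate j i ≤ j := by
  unfold alternate; split_ifs <;> omega

lemma alternate_inj {i i' j : ℕ} (h : alternate j i = alternate j i') : i = i' := by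
  unfold alternate at h; split_ifs at h <;> omega

lemma abs_slot_sub_inner {m i : ℕ} {δ : ℝ} (hi : (i + 1) / 2 ≤ m) (hδ : δ ≤ 1 / 2) :
    |slot m i δ - zigzag m (i - 1)| = 1 / 2 - δ := by
  rcases Nat.even_or_odd' i with ⟨t, rfl | rfl⟩
  · have h : zigzag m (2 * t - 1) = m + t := by unfold zigzag; split_ifs <;> omega
    have h1 : 2 * t / 2 = t := by omega
    rw [h, slot, if_pos (by omega), h1, abs_of_nonneg] <;> push_cast <;> linarith
  · have h : zigzag m (2 * t + 1 - 1) = m - t := by unfold zigzag; split_ifs <;> omega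
    have h1 : (2 * t + 1) / 2 = t := by omega
    rw [h, slot, if_neg (by omega), h1, Nat.cast_sub (by omega), abs_of_nonpos] <;> linarith

lemma abs_slot_sub_outer {m i : ℕ} {δ : ℝ} (hi : (i + 1) / 2 ≤ m) (hδ : 0 ≤ δ) :
    |slot m i δ - zigzag m (i + 1)| = 1 / 2 + δ := by
  rcases Nat.even_or_odd' i with ⟨t, rfl | rfl⟩
  · have h : zigzag m (2 * t + 1) = m + t + 1 := by unfold zigzag; split_ifs <;> omega
    have h1 : 2 * t / 2 = t := by omega
    rw [h, slot, if_pos (by omega), h1, abs_of_nonpos] <;> push_cast <;> linarith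
  · have h : zigzag m (2 * t + 1 + 1) = m - (t + 1) := by unfold zigzag; split_ifs <;> omega
    have h1 : (2 * t + 1) / 2 = t := by omega
    rw [h, slot, if_neg (by omega), h1, Nat.cast_sub (by omega), abs_of_nonneg] <;>
      push_cast <;> linarith

lemma le_abs_slot_sub_of_ne {m i s : ℕ} {δ : ℝ} (hi : (i + 1) / 2 ≤ m) (hδ : 0 ≤ δ)
    (hs : s ≠ zigzag m (i - 1)) (hs' : s ≠ zigzag m (i + 1)) :
    3 / 2 - δ ≤ |slot m i δ - s| := by
  rcases Nat.even_or_odd' i with ⟨t, rfl | rfl⟩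
  · have h : zigzag m (2 * t + 1) = m + t + 1 := by unfold zigzag; split_ifs <;> omega
    have h' : zigzag m (2 * t - 1) = m + t := by unfold zigzag; split_ifs <;> omega
    have h1 : 2 * t / 2 = t := by omega
    rw [slot, if_pos (by omega), h1, le_abs]
    have : s + 1 ≤ m + t ∨ m + t + 2 ≤ s := by omega
    rify at this
    rcases this with h | h
    · left; linarith
    · right; linarith
  · have h : zigzag m (2 * t + 1 + 1) = m - (t + 1) := by unfold zigzag; split_ifs <;> omega
    have h' : zigzag m (2 * t + 1 - 1) = m - t := by unfold zigzag; split_ifs <;> omega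
    have h1 : (2 * t + 1) / 2 = t := by omega
    rw [slot, if_neg (by omega), h1, le_abs]
    have : s + t + 2 ≤ m ∨ m + 1 ≤ s + t := by omega
    rify at this
    rcases this with h | h
    · left; linarith
    · right; linarith

lemma le_abs_slot_sub {m i : ℕ} (s : ℕ) {δ : ℝ} (hi : (i + 1) / 2 ≤ m) (hδ : 0 ≤ δ)
    (hδ' : δ ≤ 1 / 2) : 1 / 2 - δ ≤ |slot m i δ - s| := by
  by_cases h : s = zigzag m (i - 1)
  · rw [h, abs_slot_sub_inner hi hδ']
  by_cases h' : s = zigzag m (i + 1)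
  · rw [h', abs_slot_sub_outer hi hδ]; linarith
  · linarith [le_abs_slot_sub_of_ne hi hδ h h']

lemma abs_slot_sub_alternate_le {m i : ℕ} (j : ℕ) {δ : ℝ} (hi : (i + 1) / 2 ≤ m) (hδ : 0 ≤ δ)
    (hδ' : δ ≤ 1 / 2) : |slot m i δ - zigzag m (alternate j i)| ≤ 1 / 2 + δ := by
  unfold alternate
  split_ifs
  · rw [abs_slot_sub_inner hi hδ']; linarith
  · rw [abs_slot_sub_outer hi hδ]

lemma le_abs_slot_sub_zigzag {m i : ℕ} {δ : ℝ} (hi : (i + 1) / 2 ≤ m) :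
    (i : ℝ) + 1 / 2 - δ ≤ |slot m i δ - zigzag m i| := by
  rcases Nat.even_or_odd' i with ⟨t, rfl | rfl⟩
  · have h : zigzag m (2 * t) = m - t := by unfold zigzag; split_ifs <;> omega
    have h1 : 2 * t / 2 = t := by omega
    rw [h, slot, if_pos (by omega), h1, Nat.cast_sub (by omega), le_abs]
    left; push_cast; linarith
  · have h : zigzag m (2 * t + 1) = m + t + 1 := by unfold zigzag; split_ifs <;> omega
    have h1 : (2 * t + 1) / 2 = t := by omega
    rw [h, slot, if_neg (by omega), h1, le_abs]
    right; push_cast; linarith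

lemma le_abs_zigzag_sub_zigzag {K : ℕ} (hK : 1 ≤ K) :
    (K : ℝ) ≤ |(zigzag (K / 2) (K - 1) : ℝ) - zigzag (K / 2) K| := by
  have : zigzag (K / 2) (K - 1) = K + zigzag (K / 2) K ∨
      zigzag (K / 2) K = K + zigzag (K / 2) (K - 1) := by
    unfold zigzag; split_ifs <;> omega
  rcases this with h | h <;> rw [h, le_abs]
  · left; push_cast; linarith
  · right; push_cast; linarith

/-- An assignment of the first `j + 1` requests that is at least as cheap as the alternating one
uses only the first `j + 1` servers of the zigzag enumeration. -/
lemma exists_zigzag_of_sum_le {K j : ℕ} {δ : ℕ → ℝ} (hδ : ∀ i, 0 ≤ δ i)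
    (hsmall : ∀ n ≤ K, ∑ i : Fin n, δ i ≤ 1 / 4) (hdom : ∀ n, ∑ i : Fin n, δ i < δ n)
    (hj : j < K) (f : Fin (j + 1) → ℕ)
    (hle : ∑ i : Fin (j + 1), |slot (K / 2) i (δ i) - f i| ≤
      ∑ i : Fin (j + 1), |slot (K / 2) i (δ i) - zigzag (K / 2) (alternate j i)|)
    (i : Fin (j + 1)) : ∃ l, l < j + 1 ∧ f i = zigzag (K / 2) l := by
  have hpos (i : Fin (j + 1)) : ((i : ℕ) + 1) / 2 ≤ K / 2 := by have := i.2; omega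
  have hS := hsmall (j + 1) hj
  have hhalf (i : Fin (j + 1)) : δ i ≤ 1 / 2 := by
    have := Finset.single_le_sum (f := fun i : Fin (j + 1) => δ i) (fun i _ => hδ i)
      (Finset.mem_univ i)
    linarith
  have hnear (i : Fin (j + 1)) :
      f i = zigzag (K / 2) (i - 1) ∨ f i = zigzag (K / 2) (i + 1) := by
    by_contra! hfar
    have hlow : ∑ l : Fin (j + 1), ((1 / 2 - δ l) + if l = i then 1 else 0) ≤
        ∑ l : Fin (j + 1), |slot (K / 2) l (δ l) - f l| := by
      refine Finset.sum_le_sum fun l _ => ?_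
      split_ifs with h
      · subst h
        linarith [le_abs_slot_sub_of_ne (hpos l) (hδ l) hfar.1 hfar.2]
      · linarith [le_abs_slot_sub (f l) (hpos l) (hδ l) (hhalf l)]
    have hup : ∑ l : Fin (j + 1), |slot (K / 2) l (δ l) - zigzag (K / 2) (alternate j l)| ≤
        ∑ l : Fin (j + 1), (1 / 2 + δ l) :=
      Finset.sum_le_sum fun l _ => abs_slot_sub_alternate_le j (hpos l) (hδ l) (hhalf l)
    simp only [Finset.sum_add_distrib, Finset.sum_sub_distrib, Finset.sum_ite_eq',
      Finset.mem_univ, if_true] at hlow hup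
    linarith
  have hlast : f (Fin.last j) = zigzag (K / 2) (j - 1) := by
    refine (hnear (Fin.last j)).resolve_right fun hout => ?_
    rw [Fin.sum_univ_castSucc, Fin.sum_univ_castSucc] at hle
    have hlow : ∑ l : Fin j, (1 / 2 - δ l) ≤
        ∑ l : Fin j, |slot (K / 2) l.castSucc (δ l.castSucc) - f l.castSucc| :=
      Finset.sum_le_sum fun l _ =>
        le_abs_slot_sub _ (hpos l.castSucc) (hδ l.castSucc) (hhalf l.castSucc)
    have hup : ∑ l : Fin j, |slot (K / 2) l.castSucc (δ l.castSucc) -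
        zigzag (K / 2) (alternate j l.castSucc)| ≤ ∑ l : Fin j, (1 / 2 + δ l) :=
      Finset.sum_le_sum fun l _ =>
        abs_slot_sub_alternate_le j (hpos l.castSucc) (hδ l.castSucc) (hhalf l.castSucc)
    have halt : alternate j (Fin.last j) = j - 1 := by simp [alternate]
    rw [hout, halt] at hle
    have h1 := abs_slot_sub_outer (hpos (Fin.last j)) (hδ (Fin.last j))
    have h2 := abs_slot_sub_inner (hpos (Fin.last j)) (hhalf (Fin.last j))
    simp only [Fin.val_last] at h1 h2 hle
    rw [h1, h2] at hle
    simp only [Finset.sum_add_distrib, Finset.sum_sub_distrib] at hlow hup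
    linarith [hdom j]
  rcases Nat.lt_or_ge i j with h | h
  · rcases hnear i with h' | h'
    · exact ⟨_, by omega, h'⟩
    · exact ⟨_, by omega, h'⟩
  · obtain rfl : i = Fin.last j := Fin.ext (by have := i.2; simp; omega)
    exact ⟨_, by omega, hlast⟩

/-- The `j`-th server of the zigzag enumeration of `0, …, K`. -/
def zigzagServer (K : ℕ) (j : Fin (K + 1)) : Fin (K + 1) :=
  ⟨zigzag (K / 2) j, Nat.lt_succ_of_le (zigzag_le (Nat.le_of_lt_succ j.2))⟩

lemma zigzagServer_injective (K : ℕ) : Function.Injective (zigzagServer K) := fun i j h =>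
  Fin.ext (zigzag_inj (Nat.le_of_lt_succ i.2) (Nat.le_of_lt_succ j.2) (congrArg Fin.val h))

/-- Request `i < K` sits in the `i`-th slot, and the last one on the server
`zigzag (K / 2) (K - 1)`. -/
noncomputable def zigzagRequest (K : ℕ) (δ : ℕ → ℝ) (i : Fin (K + 1)) : ℝ :=
  if (i : ℕ) < K then slot (K / 2) i (δ i) else zigzag (K / 2) (K - 1)

/-- An optimal assignment of the first `n ≤ K` requests uses exactly the first `n` servers of the
zigzag enumeration. -/
lemma range_eq_of_optimal {K n : ℕ} {δ : ℕ → ℝ} (hδ : ∀ i, 0 ≤ δ i)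
    (hsmall : ∀ n ≤ K, ∑ i : Fin n, δ i ≤ 1 / 4) (hdom : ∀ n, ∑ i : Fin n, δ i < δ n)
    (hn : n ≤ K) (hnK : n ≤ K + 1) (f : Fin n → Fin (K + 1)) (hf : Function.Injective f)
    (hopt : ∀ f' : Fin n → Fin (K + 1), Function.Injective f' →
      ∑ j : Fin n, |zigzagRequest K δ (Fin.castLE hnK j) - ((f j).val : ℝ)| ≤
        ∑ j : Fin n, |zigzagRequest K δ (Fin.castLE hnK j) - ((f' j).val : ℝ)|) :
    Set.range f = Set.range (fun l : Fin n => zigzagServer K (Fin.castLE hnK l)) := by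
  obtain _ | j := n
  · simp
  have hreq (i : Fin (j + 1)) :
      zigzagRequest K δ (Fin.castLE hnK i) = slot (K / 2) i (δ i) := by
    have : (i : ℕ) < K := by have := i.2; omega
    simp [zigzagRequest, this]
  have halt (i : Fin (j + 1)) : alternate j i < K + 1 :=
    lt_of_le_of_lt (alternate_le (Nat.le_of_lt_succ i.2)) (by omega)
  have hle := hopt (fun i => zigzagServer K ⟨alternate j i, halt i⟩) (fun a b h =>
    Fin.ext (alternate_inj (congrArg Fin.val (zigzagServer_injective K h))))
  simp only [hreq, zigzagServer] at hle
  have hsub : Finset.univ.image f ⊆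
      Finset.univ.image (fun l : Fin (j + 1) => zigzagServer K (Fin.castLE hnK l)) := by
    intro s hs
    obtain ⟨i, -, rfl⟩ := Finset.mem_image.1 hs
    obtain ⟨l, hl, hfl⟩ := exists_zigzag_of_sum_le hδ hsmall hdom hn (fun i => (f i).val) hle i
    exact Finset.mem_image.2 ⟨⟨l, hl⟩, Finset.mem_univ _, Fin.ext hfl.symm⟩
  have heq := Finset.eq_of_subset_of_card_le hsub (by
    rw [Finset.card_image_of_injective _ hf]
    exact Finset.card_image_le)
  simpa using congrArg (fun s : Finset (Fin (K + 1)) => (s : Set (Fin (K + 1)))) heq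

lemma sInf_cost_zigzagRequest_le {K : ℕ} {δ : ℕ → ℝ} (hδ : ∀ i, 0 ≤ δ i)
    (hhalf : ∀ i < K, δ i ≤ 1 / 2) :
    sInf {c : ℝ | ∃ π : Equiv.Perm (Fin (K + 1)),
      c = ∑ i, |zigzagRequest K δ i - ((π i).val : ℝ)|} ≤ K / 2 + ∑ i : Fin K, δ i := by
  have halt (i : Fin (K + 1)) : alternate K i < K + 1 :=
    Nat.lt_succ_of_le (alternate_le (Nat.le_of_lt_succ i.2))
  have hinj : Function.Injective fun i : Fin (K + 1) => zigzagServer K ⟨alternate K i, halt i⟩ :=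
    fun a b h => Fin.ext (alternate_inj (congrArg Fin.val (zigzagServer_injective K h)))
  have hbdd : BddBelow {c : ℝ | ∃ π : Equiv.Perm (Fin (K + 1)),
      c = ∑ i, |zigzagRequest K δ i - ((π i).val : ℝ)|} := by
    refine ⟨0, ?_⟩
    rintro c ⟨π, rfl⟩
    positivity
  refine (csInf_le hbdd ⟨Equiv.ofBijective _ (Finite.injective_iff_bijective.1 hinj),
    rfl⟩).trans ?_
  rw [Fin.sum_univ_castSucc]
  have h : ∑ i : Fin K, |slot (K / 2) i (δ i) - zigzag (K / 2) (alternate K i)| ≤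
      ∑ i : Fin K, (1 / 2 + δ i) :=
    Finset.sum_le_sum fun i _ => abs_slot_sub_alternate_le K (by have := i.2; omega) (hδ i)
      (hhalf i i.2)
  have hK : alternate K K = K - 1 := by simp [alternate]
  simp only [Finset.sum_add_distrib, Finset.sum_const, Finset.card_univ, Fintype.card_fin,
    nsmul_eq_mul] at h
  simp only [zigzagRequest, zigzagServer, Equiv.ofBijective_apply, Fin.val_castSucc, Fin.is_lt,
    if_true, Fin.val_last, lt_irrefl, if_false, hK, sub_self, abs_zero]
  linarith

lemma le_cost_zigzagServer {K : ℕ} (hK : 1 ≤ K) (δ : ℕ → ℝ) :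
    (K : ℝ) ^ 2 / 2 + K - ∑ i : Fin K, δ i ≤
      ∑ i, |zigzagRequest K δ i - ((zigzagServer K i).val : ℝ)| := by
  rw [Fin.sum_univ_castSucc]
  have h : ∑ i : Fin K, ((i : ℝ) + 1 / 2 - δ i) ≤
      ∑ i : Fin K, |slot (K / 2) i (δ i) - zigzag (K / 2) i| :=
    Finset.sum_le_sum fun i _ => le_abs_slot_sub_zigzag (by have := i.2; omega)
  have hsum (n : ℕ) : ∑ i : Fin n, ((i : ℝ) + 1 / 2) = (n : ℝ) ^ 2 / 2 := by
    induction n with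
    | zero => simp
    | succ n ih =>
      rw [Fin.sum_univ_castSucc]
      simp only [Fin.val_castSucc, Fin.val_last, ih]
      push_cast
      ring
  rw [Finset.sum_sub_distrib, hsum] at h
  simp only [zigzagRequest, zigzagServer, Fin.val_castSucc, Fin.is_lt,
    if_true, Fin.val_last, lt_irrefl, if_false]
  linarith [le_abs_zigzag_sub_zigzag hK]

/-- There are arbitrarily small positive sequences each term of which dominates the sum of the
preceding ones. -/
lemma exists_dominating_seq (K : ℕ) {τ : ℝ} (hτ : 0 < τ) :
    ∃ δ : ℕ → ℝ, (∀ i, 0 ≤ δ i) ∧ (∀ n ≤ K, ∑ i : Fin n, δ i ≤ τ) ∧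
      ∀ n, ∑ i : Fin n, δ i < δ n := by
  have hsum (n : ℕ) : ∑ i : Fin n, τ / 2 ^ K * 2 ^ (i : ℕ) = τ / 2 ^ K * (2 ^ n - 1) := by
    rw [← Finset.mul_sum, Fin.sum_univ_eq_sum_range (fun i => (2 : ℝ) ^ i) n,
      geom_sum_eq (by norm_num)]
    norm_num
  have hpos : 0 < τ / 2 ^ K := by positivity
  refine ⟨fun i => τ / 2 ^ K * 2 ^ i, fun i => by positivity, fun n hn => ?_, fun n => ?_⟩
  · rw [hsum]
    have h : (2 : ℝ) ^ n ≤ 2 ^ K := pow_le_pow_right₀ (by norm_num) hn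
    calc τ / 2 ^ K * (2 ^ n - 1) ≤ τ / 2 ^ K * 2 ^ K := by gcongr; linarith
      _ = τ := by field_simp
  · rw [hsum]
    exact mul_lt_mul_of_pos_left (sub_one_lt _) hpos

theorem perm_alg_lower_bound (k : ℕ) (hk : 2 ≤ k) (ε : ℝ) (hε : 0 < ε) :
    ∃ r : Fin k → ℝ,
      ∀ g : Equiv.Perm (Fin k),
        (∃ f : (i : ℕ) → Fin i → Fin k,
          ∀ i, (hi : 1 ≤ i) → (hik : i ≤ k) →
            Function.Injective (f i) ∧
            (∀ f' : Fin i → Fin k, Function.Injective f' →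
              ∑ j : Fin i, |r (Fin.castLE hik j) - ((f i j).val : ℝ)| ≤
                ∑ j : Fin i, |r (Fin.castLE hik j) - ((f' j).val : ℝ)|) ∧
            Set.range (f i) =
              insert (g ⟨i - 1, by omega⟩) (Set.range (f (i - 1))) ∧
            g ⟨i - 1, by omega⟩ ∉ Set.range (f (i - 1))) →
        ∑ i : Fin k, |r i - ((g i).val : ℝ)| ≥
          ((k : ℝ) + 1 - ε) *
            sInf {c : ℝ | ∃ π : Equiv.Perm (Fin k),
              c = ∑ i : Fin k, |r i - ((π i).val : ℝ)|} := by
  obtain ⟨K, rfl⟩ : ∃ K, k = K + 1 := ⟨k - 1, by omega⟩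
  have hK : 1 ≤ K := by omega
  have hτ : 0 < min (1 / 4) (ε / (2 * ((K : ℝ) + 3))) := by positivity
  obtain ⟨δ, hδ, hsum, hdom⟩ := exists_dominating_seq K hτ
  have hsmall : ∀ n ≤ K, ∑ i : Fin n, δ i ≤ 1 / 4 := fun n hn =>
    (hsum n hn).trans (min_le_left _ _)
  have hhalf : ∀ i < K, δ i ≤ 1 / 2 := fun i hi => by
    have := Finset.single_le_sum (f := fun i : Fin K => δ i) (fun i _ => hδ i)
      (Finset.mem_univ ⟨i, hi⟩)
    linarith [hsmall K le_rfl]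
  refine ⟨zigzagRequest K δ, fun g ⟨f, hf⟩ => ?_⟩
  have hrange (n : ℕ) (hn : n ≤ K) :
      Set.range (f n) =
        Set.range (fun l : Fin n => zigzagServer K (Fin.castLE (hn.trans K.le_succ) l)) := by
    rcases Nat.eq_zero_or_pos n with rfl | hn0
    · simp
    · obtain ⟨hinj, hopt, -⟩ := hf n hn0 (hn.trans K.le_succ)
      exact range_eq_of_optimal hδ hsmall hdom hn _ _ hinj hopt
  have hg (j : Fin (K + 1)) : g j = zigzagServer K j := by
    obtain ⟨l, hl⟩ := (Finite.injective_iff_surjective.1 (zigzagServer_injective K)) (g j)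
    obtain ⟨-, -, hins, hnew⟩ := hf (j + 1) (by omega) j.2
    replace hnew : g j ∉ Set.range (f j) := hnew
    have hjl : ¬ (l : ℕ) < j := fun h => hnew <| by
      rw [hrange j (Nat.le_of_lt_succ j.2)]
      exact ⟨⟨l, h⟩, hl⟩
    have hlj : (l : ℕ) < j + 1 := by
      rcases Nat.lt_or_ge j K with h | h
      · have hmem : g j ∈ Set.range (f (j + 1)) := hins ▸ Set.mem_insert _ _
        rw [hrange (j + 1) h] at hmem
        obtain ⟨l', hl'⟩ := hmem
        have := congrArg Fin.val (zigzagServer_injective K (hl'.trans hl.symm))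
        simp only [Fin.val_castLE] at this
        omega
      · omega
    rw [← hl, Fin.ext (show (l : ℕ) = j by omega)]
  simp only [hg]
  have hlow := le_cost_zigzagServer hK δ
  have hup := sInf_cost_zigzagRequest_le hδ hhalf
  have hT := (hsum K le_rfl).trans (min_le_right _ _)
  have hT0 : 0 ≤ ∑ i : Fin K, δ i := Finset.sum_nonneg fun i _ => hδ i
  have hinf : 0 ≤ sInf {c : ℝ | ∃ π : Equiv.Perm (Fin (K + 1)),
      c = ∑ i, |zigzagRequest K δ i - ((π i).val : ℝ)|} := by
    refine Real.sInf_nonneg ?_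
    rintro c ⟨π, rfl⟩
    positivity
  rw [le_div_iff₀ (by positivity)] at hT
  have hK' : (1 : ℝ) ≤ K := by exact_mod_cast hK
  push_cast
  rcases le_total ((K : ℝ) + 1 + 1 - ε) 0 with hneg | hnonneg
  · exact (mul_nonpos_of_nonpos_of_nonneg hneg hinf).trans (by positivity)
  · refine (mul_le_mul_of_nonneg_left hup hnonneg).trans (le_trans ?_ hlow)
    nlinarith [mul_nonneg hε.le hT0, mul_le_mul_of_nonneg_left hK' hε.le]
end

section
/- Let k ≥ 1 and ℓ ≥ 1 be integers and let A be an online algorithm that is feasible both for OFAL_eq(k,1) and for OFAL_eq(k,ℓ). If R_{k,1}(A) < ∞, then R_{k,ℓ}(A) ≥ R_{k,1}(A). -/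
/-- The competitive ratio `R_{k,c}(A)`, as an extended real: the infimum of all
real `α ≥ 1` such that `A` is α-competitive for OFAL_eq(k,c); it is `⊤` when no
such α exists. -/
noncomputable def ratio (k c : ℕ) (A : List ℝ → Fin k) : EReal :=
  sInf {x : EReal | ∃ α : ℝ, x = (α : EReal) ∧ 1 ≤ α ∧
    ∀ σ : List ℝ, σ.length ≤ k * c → algCost k A σ ≤ α * optCost k c σ}

/-- Raising the capacity from `c` to `d` can only lower the optimal cost of a sequence of at most
`k` requests; for `c ≥ 1` such a sequence has an admissible assignment. -/
theorem optCost_anti {k c d : ℕ} (hc : 1 ≤ c) (hcd : c ≤ d) {σ : List ℝ} (hσ : σ.length ≤ k) :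
    optCost k d σ ≤ optCost k c σ := by
  refine csInf_le_csInf ⟨0, ?_⟩ ⟨_, Fin.castLE hσ, fun s => ?_, rfl⟩ ?_
  · rintro x ⟨f, -, rfl⟩
    positivity
  · refine (Finset.card_le_one.2 fun a ha b hb => ?_).trans hc
    exact Fin.castLE_injective hσ
      ((Finset.mem_filter.1 ha).2.trans (Finset.mem_filter.1 hb).2.symm)
  · rintro x ⟨f, hf, rfl⟩
    exact ⟨f, fun s => (hf s).trans hcd, rfl⟩

theorem ratio_capacity_one_le (k ℓ : ℕ) (hk : 1 ≤ k) (hℓ : 1 ≤ ℓ)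
    (A : List ℝ → Fin k) (h1 : Feasible k 1 A) (hℓfeas : Feasible k ℓ A)
    (hfin : ratio k 1 A < ⊤) :
    ratio k 1 A ≤ ratio k ℓ A := by
  refine sInf_le_sInf ?_
  rintro x ⟨α, rfl, hα, h⟩
  refine ⟨α, rfl, hα, fun σ hσ => ?_⟩
  calc algCost k A σ ≤ α * optCost k ℓ σ := h σ (hσ.trans (Nat.mul_le_mul_left k hℓ))
    _ ≤ α * optCost k 1 σ :=
      mul_le_mul_of_nonneg_left (optCost_anti le_rfl hℓ (by simpa using hσ)) (by linarith)
end

section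
/- Let k ≥ 1 and ℓ ≥ 1 be integers, let σ' = r'_1,...,r'_k be any sequence of k reals, and let σ be the request sequence consisting of ℓ-1 requests placed at each of the positions 0, 1, ..., k-1 (a total of k(ℓ-1) requests), followed by r'_1,...,r'_k. Then OPT_ℓ(σ) = OPT_1(σ'), where OPT_1(σ') is the minimum over injections g : {1,...,k} → {1,...,k} of Σ_{i=1}^k |r'_i - (g(i)-1)|. -/
theorem Fintype.sum_update_add {ι α M : Type*} [Fintype ι] [DecidableEq ι] [AddCommMonoid M]
    (F : ι → α → M) (f : ι → α) (j : ι) (t : α) :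
    ∑ i, F i (Function.update f j t i) + F j (f j) = ∑ i, F i (f i) + F j t := by
  rw [← Finset.add_sum_erase _ _ (Finset.mem_univ j),
    ← Finset.add_sum_erase Finset.univ (fun i => F i (f i)) (Finset.mem_univ j),
    Finset.sum_congr rfl (g := fun i => F i (f i))
      (fun i hi => by rw [Function.update_of_ne (Finset.ne_of_mem_erase hi)])]
  simp only [Function.update_self]
  rw [add_right_comm, add_comm (F j t), add_right_comm, add_right_comm]

/-- `x` is the cost of an assignment of the requests `σ` in which server `s` is used at most `c s`
times. -/
def IsAssignmentCost {k : ℕ} (c : Fin k → ℕ) (σ : List ℝ) (x : ℝ) : Prop :=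
  ∃ f : Fin σ.length → Fin k,
    (∀ s : Fin k, (Finset.univ.filter fun i => f i = s).card ≤ c s) ∧
    x = ∑ i : Fin σ.length, |σ.get i - ((f i).val : ℝ)|

namespace IsAssignmentCost

variable {k : ℕ} {c : Fin k → ℕ} {σ : List ℝ} {x : ℝ}

theorem nonneg (h : IsAssignmentCost c σ x) : 0 ≤ x := by
  obtain ⟨f, -, rfl⟩ := h
  positivity

theorem cons_server (h : IsAssignmentCost c σ x) (p : Fin k) :
    IsAssignmentCost (fun s => (if p = s then 1 else 0) + c s) ((p.val : ℝ) :: σ) x := by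
  obtain ⟨f, hf, rfl⟩ := h
  refine ⟨Fin.cons p f, fun s => ?_, ?_⟩
  · have := hf s
    rw [Finset.card_filter] at this ⊢
    refine (Fin.sum_univ_succ (n := σ.length) _).trans_le ?_
    simpa using this
  · refine Eq.trans ?_ (Fin.sum_univ_succ (n := σ.length) _).symm
    simp

/-- A request located at a server may be served by that server, by an exchange argument. -/
theorem exists_le_of_cons_server (p : Fin k)
    (h : IsAssignmentCost (fun s => (if p = s then 1 else 0) + c s) ((p.val : ℝ) :: σ) x) :
    ∃ y ≤ x, IsAssignmentCost c σ y := by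
  obtain ⟨f, hf, rfl⟩ := h
  obtain ⟨t, g, rfl⟩ : ∃ t g, f = Fin.cons t g := ⟨_, _, (Fin.cons_self_tail f).symm⟩
  have hg : ∀ s, (if t = s then 1 else 0) + (∑ i, if g i = s then 1 else 0) ≤
      (if p = s then 1 else 0) + c s := fun s => by
    have := hf s
    rw [Finset.card_filter] at this
    replace this := (Fin.sum_univ_succ (n := σ.length) _).symm.trans_le this
    simpa using this
  have hcost : ∑ i, |((p.val : ℝ) :: σ).get i -
      (((Fin.cons t g : Fin (σ.length + 1) → Fin k) i).val : ℝ)| =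
      |(p.val : ℝ) - t.val| + ∑ i, |σ.get i - ((g i).val : ℝ)| := by
    refine (Fin.sum_univ_succ _).trans ?_
    simp
  by_cases hp : ∃ j, g j = p
  · obtain ⟨j, hj⟩ := hp
    refine ⟨_, ?_, Function.update g j t, fun s => ?_, rfl⟩
    · have := Fintype.sum_update_add (fun i (s : Fin k) => |σ.get i - (s.val : ℝ)|) g j t
      simp only [hj] at this
      have tri := abs_sub_le (σ.get j) (p.val : ℝ) (t.val : ℝ)
      refine le_of_le_of_eq ?_ hcost.symm
      linarith
    · have := Fintype.sum_update_add (fun _ (u : Fin k) => if u = s then 1 else 0) g j t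
      have := hg s
      rw [Finset.card_filter]
      simp only [hj] at *
      omega
  · refine ⟨_, ?_, g, fun s => ?_, rfl⟩
    · refine le_of_le_of_eq ?_ hcost.symm
      have := abs_nonneg ((p.val : ℝ) - t.val)
      linarith
    · have := hg s
      rw [Finset.card_filter]
      by_cases hs : p = s
      · subst hs
        rw [Finset.sum_eq_zero fun i _ => if_neg fun h => hp ⟨i, h⟩]
        exact Nat.zero_le _
      · rw [if_neg hs] at this
        omega

theorem append_servers (h : IsAssignmentCost c σ x) (P : List (Fin k)) :
    IsAssignmentCost (fun s => P.count s + c s) (P.map (fun p => (p.val : ℝ)) ++ σ) x := by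
  induction P with
  | nil => simpa using h
  | cons p P ih =>
    convert ih.cons_server p using 2 with s
    · simp only [List.count_cons, beq_iff_eq]
      omega
    · simp

theorem exists_le_of_append_servers (P : List (Fin k))
    (h : IsAssignmentCost (fun s => P.count s + c s) (P.map (fun p => (p.val : ℝ)) ++ σ) x) :
    ∃ y ≤ x, IsAssignmentCost c σ y := by
  induction P generalizing x with
  | nil => exact ⟨x, le_rfl, by simpa using h⟩
  | cons p P ih =>
    obtain ⟨y, hyx, hy⟩ := exists_le_of_cons_server (c := fun s => P.count s + c s)
        (σ := P.map (fun p => (p.val : ℝ)) ++ σ) p (by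
      convert h using 2 with s
      · simp only [List.count_cons, beq_iff_eq]
        omega
      · simp)
    obtain ⟨z, hzy, hz⟩ := ih hy
    exact ⟨z, hzy.trans hyx, hz⟩

theorem ofFn_one_iff {n : ℕ} {r : Fin n → ℝ} :
    IsAssignmentCost (fun _ : Fin k => 1) (List.ofFn r) x ↔
      ∃ g : Fin n → Fin k, Function.Injective g ∧ x = ∑ i, |r i - ((g i).val : ℝ)| := by
  have key : ∀ {m : ℕ} (f : Fin m → Fin k),
      (∀ s, (Finset.univ.filter fun i => f i = s).card ≤ 1) ↔ Function.Injective f := fun f => by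
    simp only [Finset.card_le_one, Finset.mem_filter, Finset.mem_univ, true_and]
    exact ⟨fun h a b hab => h _ a hab b rfl, fun h s a ha b hb => h (ha.trans hb.symm)⟩
  simp only [IsAssignmentCost, key]
  let e : Fin n ≃ Fin (List.ofFn r).length := finCongr List.length_ofFn.symm
  constructor
  · rintro ⟨f, hf, rfl⟩
    refine ⟨f ∘ e, hf.comp e.injective, ?_⟩
    rw [← e.sum_comp]
    simp [e]
  · rintro ⟨g, hg, rfl⟩
    refine ⟨g ∘ e.symm, hg.comp e.symm.injective, ?_⟩
    rw [← e.sum_comp]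
    simp [e]

end IsAssignmentCost

theorem List.count_flatMap_replicate_finRange {k : ℕ} (m : ℕ) (s : Fin k) :
    ((List.finRange k).flatMap fun i => List.replicate m i).count s = m := by
  rw [List.count_flatMap, ← List.ofFn_eq_map, List.sum_ofFn]
  simp [List.count_replicate]

theorem opt_fill_then_requests (k ℓ : ℕ) (hk : 1 ≤ k) (hℓ : 1 ≤ ℓ)
    (r' : Fin k → ℝ) :
    optCost k ℓ
        (((List.range k).flatMap fun i => List.replicate (ℓ - 1) (i : ℝ)) ++
          List.ofFn r') =
      sInf {c : ℝ | ∃ g : Fin k → Fin k, Function.Injective g ∧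
        c = ∑ i : Fin k, |r' i - ((g i).val : ℝ)|} := by
  set P := (List.finRange k).flatMap fun i => List.replicate (ℓ - 1) i with hP
  have hfill : ((List.range k).flatMap fun i => List.replicate (ℓ - 1) (i : ℝ)) =
      P.map fun p => (p.val : ℝ) := by
    simp only [hP, List.map_flatMap, List.map_replicate, List.bind_eq_flatMap, List.pure_def,
      List.flatMap_assoc, List.flatMap_singleton]
    rw [← List.map_coe_finRange_eq_range, List.flatMap_map]
  have hcap : (fun s => P.count s + 1) = fun _ : Fin k => ℓ := by
    funext s
    rw [hP, List.count_flatMap_replicate_finRange]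
    omega
  rw [hfill]
  simp only [← IsAssignmentCost.ofFn_one_iff]
  change sInf {x | IsAssignmentCost (fun _ : Fin k => ℓ) _ x} = _
  have hne : {c | IsAssignmentCost (fun _ : Fin k => 1) (List.ofFn r') c}.Nonempty :=
    ⟨_, IsAssignmentCost.ofFn_one_iff.2 ⟨id, Function.injective_id, rfl⟩⟩
  have hsub : {c | IsAssignmentCost (fun _ : Fin k => 1) (List.ofFn r') c} ⊆
      {x | IsAssignmentCost (fun _ : Fin k => ℓ)
        (P.map (fun p => (p.val : ℝ)) ++ List.ofFn r') x} := fun x hx => by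
    have := hx.append_servers P
    rwa [hcap] at this
  refine le_antisymm (csInf_le_csInf ⟨0, fun x hx => hx.nonneg⟩ hne hsub)
    (le_csInf (hne.mono hsub) fun x hx => ?_)
  obtain ⟨y, hyx, hy⟩ := IsAssignmentCost.exists_le_of_append_servers (σ := List.ofFn r') (c := fun _ => 1) P
    (by rw [hcap]; exact hx)
  exact (csInf_le (s := {c | IsAssignmentCost (fun _ : Fin k => 1) (List.ofFn r') c})
    ⟨0, fun z hz => hz.nonneg⟩ hy).trans hyx
end
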